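/- For every integer n ≥ 3, every optimal set of n-means for the condensation measure P contains no point of the open interval (1/5, 2/5) and no point of the open interval (3/5, 4/5). -/

import Mathlib

open MeasureTheory Metric Set Filter

/-- The distortion error of a set `α` of quantizer points for `μ`, of order 2:
`∫ min_{a ∈ α} (x - a)^2 dμ(x)`. -/
noncomputable def distortion (μ : MeasureTheory.Measure ℝ) (α : Set ℝ) : ℝ :=
  ∫ x, (Metric.infDist x α) ^ 2 ∂μ

/-- The `n`th quantization error of order 2 for `μ`. -/
noncomputable def quantErr (μ : MeasureTheory.Measure ℝ) (n : ℕ) : ℝ :=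
  sInf {e : ℝ | ∃ α : Set ℝ, α.Finite ∧ α.Nonempty ∧ α.ncard ≤ n ∧ e = distortion μ α}

/-- `α` is an optimal set of `n`-means for `μ`. -/
def IsOptimalSet (μ : MeasureTheory.Measure ℝ) (n : ℕ) (α : Set ℝ) : Prop :=
  α.Finite ∧ α.Nonempty ∧ α.ncard ≤ n ∧ distortion μ α = quantErr μ n

/-- The similarity `S₁(x) = x/5`. -/
noncomputable def S1 : ℝ → ℝ := fun x => x / 5

/-- The similarity `S₂(x) = x/5 + 4/5`. -/
noncomputable def S2 : ℝ → ℝ := fun x => x / 5 + 4 / 5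

/-- `P` is the condensation measure associated with `(S₁, S₂; 1/3, 1/3, 1/3; ν)`:
`P = (1/3) P∘S₁⁻¹ + (1/3) P∘S₂⁻¹ + (1/3) ν`. -/
def IsCondensation (P ν : MeasureTheory.Measure ℝ) : Prop :=
  MeasureTheory.IsProbabilityMeasure P ∧
    P = (1 / 3 : ENNReal) • P.map S1 + (1 / 3 : ENNReal) • P.map S2 + (1 / 3 : ENNReal) • ν

/-- The uniform distribution on `[2/5, 3/5]`, i.e. the measure with density
`5 · 1_{[2/5, 3/5]}` with respect to Lebesgue measure. -/
noncomputable def nuUnif : MeasureTheory.Measure ℝ :=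
  (5 : ENNReal) • (MeasureTheory.volume.restrict (Set.Icc (2 / 5 : ℝ) (3 / 5)))

/-! ### Distance to a finite set of reals -/

lemma infDist_sq_le {α : Set ℝ} {x g : ℝ} (hg : g ∈ α) : infDist x α ^ 2 ≤ (x - g) ^ 2 := by
  have h := infDist_le_dist_of_mem (x := x) hg
  rw [Real.dist_eq] at h
  calc infDist x α ^ 2 ≤ |x - g| ^ 2 := pow_le_pow_left₀ infDist_nonneg h 2
    _ = (x - g) ^ 2 := sq_abs _

lemma exists_infDist_sq_eq {α : Set ℝ} (hf : α.Finite) (hne : α.Nonempty) (x : ℝ) :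
    ∃ g ∈ α, infDist x α ^ 2 = (x - g) ^ 2 := by
  obtain ⟨g, hg, h⟩ := hf.isCompact.exists_infDist_eq_dist hne x
  exact ⟨g, hg, by rw [h, Real.dist_eq, sq_abs]⟩

lemma le_infDist_sq {α : Set ℝ} (hf : α.Finite) (hne : α.Nonempty) {x c : ℝ}
    (h : ∀ g ∈ α, c ≤ (x - g) ^ 2) : c ≤ infDist x α ^ 2 := by
  obtain ⟨g, hg, hx⟩ := exists_infDist_sq_eq hf hne x
  exact hx ▸ h g hg

lemma infDist_sq_le_infDist_sq {α β : Set ℝ} (hf : α.Finite) (hne : α.Nonempty) {x : ℝ}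
    (h : ∀ g ∈ α, ∃ k ∈ β, (x - k) ^ 2 ≤ (x - g) ^ 2) : infDist x β ^ 2 ≤ infDist x α ^ 2 :=
  le_infDist_sq hf hne fun g hg =>
    let ⟨_, hk, hkg⟩ := h g hg
    (infDist_sq_le hk).trans hkg

lemma infDist_sq_anti {α β : Set ℝ} (h : α ⊆ β) (hne : α.Nonempty) (x : ℝ) :
    infDist x β ^ 2 ≤ infDist x α ^ 2 :=
  pow_le_pow_left₀ infDist_nonneg (infDist_le_infDist_of_subset h hne) 2

lemma continuous_infDist_sq (α : Set ℝ) : Continuous fun x : ℝ => infDist x α ^ 2 :=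
  (continuous_infDist_pt α).pow 2

lemma infDist_one_sub (α : Set ℝ) (x : ℝ) :
    infDist (1 - x) α = infDist x ((fun y => 1 - y) ⁻¹' α) := by
  have h := infDist_image (x := x) (t := (fun y => 1 - y) ⁻¹' α)
    (Φ := fun y : ℝ => 1 - y) (Isometry.of_dist_eq fun a b => by
      rw [dist_sub_left])
  rw [image_preimage_eq _ (fun y => ⟨1 - y, by ring⟩)] at h
  exact h

/-! ### Integration against the condensation measure -/

lemma nuUnif_eq_zero {s : Set ℝ} (hs : s ∩ Icc (2 / 5 : ℝ) (3 / 5) = ∅) (hm : MeasurableSet s) :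
    nuUnif s = 0 := by
  simp [nuUnif, Measure.restrict_apply hm, hs]

lemma IsCondensation.apply {P ν : Measure ℝ} (hP : IsCondensation P ν) {s : Set ℝ}
    (hs : MeasurableSet s) :
    P s = 1 / 3 * P (S1 ⁻¹' s) + 1 / 3 * P (S2 ⁻¹' s) + 1 / 3 * ν s := by
  have h1 : Measurable S1 := by unfold S1; fun_prop
  have h2 : Measurable S2 := by unfold S2; fun_prop
  conv_lhs => rw [hP.2]
  simp [Measure.map_apply h1 hs, Measure.map_apply h2 hs]

lemma eq_zero_of_le_two_thirds {x : ENNReal} (hx : x ≠ ⊤) (h : x ≤ 1 / 3 * x + 1 / 3 * x) :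
    x = 0 := by
  lift x to NNReal using hx
  have h3 : (1 / 3 : ENNReal) = ((1 / 3 : NNReal) : ENNReal) := by
    rw [ENNReal.coe_div (by norm_num)]; simp
  rw [h3] at h
  norm_cast at h ⊢
  have h' : (x : ℝ) ≤ 1 / 3 * x + 1 / 3 * x := by exact_mod_cast h
  have : (x : ℝ) ≤ 0 := by linarith
  exact le_antisymm (by exact_mod_cast this) bot_le

lemma IsCondensation.measure_eq_zero {P : Measure ℝ} (hP : IsCondensation P nuUnif) {s : Set ℝ}
    (hm : MeasurableSet s) (h : s ∩ Icc (2 / 5 : ℝ) (3 / 5) = ∅) (h1 : S1 ⁻¹' s ⊆ s)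
    (h2 : S2 ⁻¹' s ⊆ s) : P s = 0 := by
  have := hP.1
  refine eq_zero_of_le_two_thirds (measure_ne_top _ _) ?_
  conv_lhs => rw [hP.apply hm, nuUnif_eq_zero h hm, mul_zero, add_zero]
  gcongr

lemma IsCondensation.measure_Iio {P : Measure ℝ} (hP : IsCondensation P nuUnif) :
    P (Iio 0) = 0 := by
  refine hP.measure_eq_zero measurableSet_Iio ?_ ?_ ?_
  · ext x; simp only [mem_inter_iff, mem_Iio, mem_Icc, mem_empty_iff_false, iff_false]
    rintro ⟨h, h', -⟩; linarith
  · intro x hx; simp only [S1, mem_preimage, mem_Iio] at hx ⊢; linarith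
  · intro x hx; simp only [S2, mem_preimage, mem_Iio] at hx ⊢; linarith

lemma IsCondensation.measure_Ioi {P : Measure ℝ} (hP : IsCondensation P nuUnif) :
    P (Ioi 1) = 0 := by
  refine hP.measure_eq_zero measurableSet_Ioi ?_ ?_ ?_
  · ext x; simp only [mem_inter_iff, mem_Ioi, mem_Icc, mem_empty_iff_false, iff_false]
    rintro ⟨h, -, h'⟩; linarith
  · intro x hx; simp only [S1, mem_preimage, mem_Ioi] at hx ⊢; linarith
  · intro x hx; simp only [S2, mem_preimage, mem_Ioi] at hx ⊢; linarith

lemma IsCondensation.measure_gap {P : Measure ℝ} (hP : IsCondensation P nuUnif) :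
    P (Ioo (1 / 5) (2 / 5)) = 0 := by
  rw [hP.apply measurableSet_Ioo, nuUnif_eq_zero _ measurableSet_Ioo,
    measure_mono_null _ hP.measure_Ioi, measure_mono_null _ hP.measure_Iio]
  · simp
  · intro x hx; simp only [S2, mem_preimage, mem_Ioo, mem_Iio] at hx ⊢; linarith
  · intro x hx; simp only [S1, mem_preimage, mem_Ioo, mem_Ioi] at hx ⊢; linarith
  · ext x; simp only [mem_inter_iff, mem_Ioo, mem_Icc, mem_empty_iff_false, iff_false]
    rintro ⟨⟨h, h''⟩, h', -⟩; linarith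

lemma IsCondensation.ae_mem_Icc {P : Measure ℝ} (hP : IsCondensation P nuUnif) :
    ∀ᵐ x ∂P, x ∈ Icc (0 : ℝ) 1 := by
  filter_upwards [compl_mem_ae_iff.2 hP.measure_Iio, compl_mem_ae_iff.2 hP.measure_Ioi]
    with x h0 h1
  exact ⟨not_lt.1 h0, not_lt.1 h1⟩

lemma IsCondensation.integrable {P : Measure ℝ} (hP : IsCondensation P nuUnif) {F : ℝ → ℝ}
    (hF : Continuous F) : Integrable F P := by
  have := hP.1
  have h : IntegrableOn F (Icc 0 1) P := hF.continuousOn.integrableOn_compact isCompact_Icc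
  rwa [IntegrableOn, Measure.restrict_eq_self_of_ae_mem hP.ae_mem_Icc] at h

lemma integral_nuUnif (F : ℝ → ℝ) : ∫ x, F x ∂nuUnif = 5 * ∫ x in (2 / 5)..(3 / 5), F x := by
  rw [nuUnif, integral_smul_measure, intervalIntegral.integral_of_le (by norm_num),
    integral_Icc_eq_integral_Ioc]
  simp

lemma IsCondensation.integral_eq {P : Measure ℝ} (hP : IsCondensation P nuUnif) {F : ℝ → ℝ}
    (hF : Continuous F) :
    ∫ x, F x ∂P = ((∫ y, F (y / 5) ∂P) + (5 * ∫ x in (2 / 5)..(3 / 5), F x) +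
      ∫ y, F (y / 5 + 4 / 5) ∂P) / 3 := by
  have h1 : Continuous S1 := by unfold S1; fun_prop
  have h2 : Continuous S2 := by unfold S2; fun_prop
  have i1 : Integrable F (P.map S1) :=
    (integrable_map_measure hF.aestronglyMeasurable h1.aemeasurable).2 (hP.integrable (hF.comp h1))
  have i2 : Integrable F (P.map S2) :=
    (integrable_map_measure hF.aestronglyMeasurable h2.aemeasurable).2 (hP.integrable (hF.comp h2))
  have i3 : Integrable F nuUnif :=
    (hF.continuousOn.integrableOn_compact isCompact_Icc).smul_measure (by simp)
  have c : (1 / 3 : ENNReal) ≠ ⊤ := by simp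
  conv_lhs => rw [hP.2]
  rw [integral_add_measure ((i1.smul_measure c).add_measure (i2.smul_measure c))
      (i3.smul_measure c), integral_add_measure (i1.smul_measure c) (i2.smul_measure c),
    integral_smul_measure, integral_smul_measure, integral_smul_measure, integral_nuUnif,
    integral_map h1.aemeasurable hF.aestronglyMeasurable,
    integral_map h2.aemeasurable hF.aestronglyMeasurable]
  simp [S1, S2]
  ring

lemma integral_quadratic (a b c u v : ℝ) :
    ∫ x in u..v, (a * x ^ 2 + b * x + c) =
      a * (v ^ 3 - u ^ 3) / 3 + b * (v ^ 2 - u ^ 2) / 2 + c * (v - u) := by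
  have h : ∀ x ∈ uIcc u v, HasDerivAt (fun x => a * x ^ 3 / 3 + b * x ^ 2 / 2 + c * x)
      (a * x ^ 2 + b * x + c) x := fun x _ => by
    have h3 := ((hasDerivAt_pow 3 x).const_mul a).div_const 3
    have h2 := ((hasDerivAt_pow 2 x).const_mul b).div_const 2
    refine ((h3.add h2).add ((hasDerivAt_id x).const_mul c)).congr_deriv ?_
    push_cast
    ring
  rw [intervalIntegral.integral_eq_sub_of_hasDerivAt h
    (Continuous.intervalIntegrable (by fun_prop) _ _)]
  ring

lemma quadratic_le_integral {u v a b c : ℝ} (huv : u ≤ v) {F : ℝ → ℝ} (hF : Continuous F)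
    (h : ∀ x, u ≤ x → x ≤ v → a * x ^ 2 + b * x + c ≤ F x) :
    a * (v ^ 3 - u ^ 3) / 3 + b * (v ^ 2 - u ^ 2) / 2 + c * (v - u) ≤ ∫ x in u..v, F x := by
  rw [← integral_quadratic]
  exact intervalIntegral.integral_mono_on huv (Continuous.intervalIntegrable (by fun_prop) _ _)
    (hF.intervalIntegrable _ _) fun x hx => h x hx.1 hx.2

lemma integral_le_quadratic {u v a b c : ℝ} (huv : u ≤ v) {F : ℝ → ℝ} (hF : Continuous F)
    (h : ∀ x, u ≤ x → x ≤ v → F x ≤ a * x ^ 2 + b * x + c) :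
    ∫ x in u..v, F x ≤ a * (v ^ 3 - u ^ 3) / 3 + b * (v ^ 2 - u ^ 2) / 2 + c * (v - u) := by
  rw [← integral_quadratic]
  exact intervalIntegral.integral_mono_on huv (hF.intervalIntegrable _ _)
    (Continuous.intervalIntegrable (by fun_prop) _ _) fun x hx => h x hx.1 hx.2

lemma IsCondensation.integral_quadratic {P : Measure ℝ} (hP : IsCondensation P nuUnif)
    (a b c : ℝ) : ∫ x, (a * x ^ 2 + b * x + c) ∂P = a * (79 / 219) + b / 2 + c := by
  have := hP.1
  have i2 : Integrable (fun x : ℝ => x ^ 2) P := hP.integrable (by fun_prop)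
  have i1 : Integrable (fun x : ℝ => x) P := hP.integrable (by fun_prop)
  have key : ∀ a b c : ℝ, ∫ x, (a * x ^ 2 + b * x + c) ∂P =
      a * ∫ x, x ^ 2 ∂P + b * ∫ x, x ∂P + c := fun a b c => by
    have i3 : Integrable (fun x : ℝ => a * x ^ 2 + b * x) P := hP.integrable (by fun_prop)
    rw [integral_add i3 (integrable_const c), integral_add (i2.const_mul a) (i1.const_mul b),
      integral_const_mul, integral_const_mul]
    simp
  have e1 := hP.integral_eq (F := fun x => 0 * x ^ 2 + 1 * x + 0) (by fun_prop)
  have e2 := hP.integral_eq (F := fun x => 1 * x ^ 2 + 0 * x + 0) (by fun_prop)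
  rw [_root_.integral_quadratic, key,
    show (fun y : ℝ => 0 * (y / 5) ^ 2 + 1 * (y / 5) + 0) =
      fun y => 0 * y ^ 2 + (1 / 5) * y + 0 by ext; ring, key,
    show (fun y : ℝ => 0 * (y / 5 + 4 / 5) ^ 2 + 1 * (y / 5 + 4 / 5) + 0) =
      fun y => 0 * y ^ 2 + (1 / 5) * y + 4 / 5 by ext; ring, key] at e1
  rw [_root_.integral_quadratic, key,
    show (fun y : ℝ => 1 * (y / 5) ^ 2 + 0 * (y / 5) + 0) =
      fun y => (1 / 25) * y ^ 2 + 0 * y + 0 by ext; ring, key,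
    show (fun y : ℝ => 1 * (y / 5 + 4 / 5) ^ 2 + 0 * (y / 5 + 4 / 5) + 0) =
      fun y => (1 / 25) * y ^ 2 + (8 / 25) * y + 16 / 25 by ext; ring, key] at e2
  have m1 : ∫ x, x ∂P = 1 / 2 := by linarith
  have m2 : ∫ x, x ^ 2 ∂P = 79 / 219 := by rw [m1] at e2; linarith
  rw [key, m1, m2]; ring

lemma IsCondensation.quadratic_le_integral {P : Measure ℝ} (hP : IsCondensation P nuUnif)
    {a b c : ℝ} {F : ℝ → ℝ} (hF : Continuous F)
    (h : ∀ x, 0 ≤ x → x ≤ 1 → a * x ^ 2 + b * x + c ≤ F x) :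
    a * (79 / 219) + b / 2 + c ≤ ∫ x, F x ∂P := by
  rw [← hP.integral_quadratic]
  refine integral_mono_ae (hP.integrable (by fun_prop)) (hP.integrable hF) ?_
  filter_upwards [hP.ae_mem_Icc] with x hx using h x hx.1 hx.2

lemma IsCondensation.integral_le_quadratic {P : Measure ℝ} (hP : IsCondensation P nuUnif)
    {a b c : ℝ} {F : ℝ → ℝ} (hF : Continuous F)
    (h : ∀ x, 0 ≤ x → x ≤ 1 → F x ≤ a * x ^ 2 + b * x + c) :
    ∫ x, F x ∂P ≤ a * (79 / 219) + b / 2 + c := by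
  rw [← hP.integral_quadratic]
  refine integral_mono_ae (hP.integrable hF) (hP.integrable (by fun_prop)) ?_
  filter_upwards [hP.ae_mem_Icc] with x hx using h x hx.1 hx.2

/-! ### The three parts of the distortion -/

/-- Normalized distortion of `α` on `S1 [0,1]`. -/
noncomputable def leftCost (P : Measure ℝ) (α : Set ℝ) : ℝ :=
  ∫ y, infDist (y / 5) α ^ 2 ∂P

/-- Distortion of `α` for the uniform distribution on `[2/5, 3/5]`. -/
noncomputable def midCost (α : Set ℝ) : ℝ :=
  5 * ∫ x in (2 / 5)..(3 / 5), infDist x α ^ 2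

/-- Normalized distortion of `α` on `S2 [0,1]`. -/
noncomputable def rightCost (P : Measure ℝ) (α : Set ℝ) : ℝ :=
  ∫ y, infDist (y / 5 + 4 / 5) α ^ 2 ∂P

section Costs

variable {P : Measure ℝ} {α β : Set ℝ} {n : ℕ}

lemma distortion_eq (hP : IsCondensation P nuUnif) (α : Set ℝ) :
    distortion P α = (leftCost P α + midCost α + rightCost P α) / 3 :=
  hP.integral_eq (continuous_infDist_sq α)

lemma leftCost_mono (hP : IsCondensation P nuUnif)
    (h : ∀ x, 0 ≤ x → x ≤ 1 / 5 → infDist x α ^ 2 ≤ infDist x β ^ 2) :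
    leftCost P α ≤ leftCost P β := by
  refine integral_mono_ae (hP.integrable ((continuous_infDist_sq α).comp (by fun_prop)))
    (hP.integrable ((continuous_infDist_sq β).comp (by fun_prop))) ?_
  filter_upwards [hP.ae_mem_Icc] with y hy
  exact h _ (by linarith [hy.1]) (by linarith [hy.2])

lemma rightCost_mono (hP : IsCondensation P nuUnif)
    (h : ∀ x, 4 / 5 ≤ x → x ≤ 1 → infDist x α ^ 2 ≤ infDist x β ^ 2) :
    rightCost P α ≤ rightCost P β := by
  refine integral_mono_ae (hP.integrable ((continuous_infDist_sq α).comp (by fun_prop)))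
    (hP.integrable ((continuous_infDist_sq β).comp (by fun_prop))) ?_
  filter_upwards [hP.ae_mem_Icc] with y hy
  exact h _ (by linarith [hy.1]) (by linarith [hy.2])

lemma midCost_mono
    (h : ∀ x, 2 / 5 ≤ x → x ≤ 3 / 5 → infDist x α ^ 2 ≤ infDist x β ^ 2) :
    midCost α ≤ midCost β := by
  refine mul_le_mul_of_nonneg_left ?_ (by norm_num)
  exact intervalIntegral.integral_mono_on (by norm_num)
    ((continuous_infDist_sq α).intervalIntegrable _ _)
    ((continuous_infDist_sq β).intervalIntegrable _ _) fun x hx => h x hx.1 hx.2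

lemma leftCost_nonneg : 0 ≤ leftCost P α := integral_nonneg fun _ => by positivity

lemma midCost_nonneg : 0 ≤ midCost α :=
  mul_nonneg (by norm_num)
    (intervalIntegral.integral_nonneg (by norm_num) fun _ _ => by positivity)

lemma rightCost_nonneg : 0 ≤ rightCost P α := integral_nonneg fun _ => by positivity

lemma quantErr_le (hf : β.Finite) (hne : β.Nonempty) (hc : β.ncard ≤ n) :
    quantErr P n ≤ distortion P β :=
  csInf_le ⟨0, by rintro _ ⟨γ, -, -, -, rfl⟩; exact integral_nonneg fun _ => by positivity⟩
    ⟨β, hf, hne, hc, rfl⟩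

/-- An optimal set does at least as well as any three sets, used one on each part. -/
lemma IsOptimalSet.cost_le (hP : IsCondensation P nuUnif) (hα : IsOptimalSet P n α)
    {A B C : Set ℝ} (hA : A.Finite) (hA' : A.Nonempty) (hB : B.Finite) (hB' : B.Nonempty)
    (hC : C.Finite) (hC' : C.Nonempty) (hn : A.ncard + B.ncard + C.ncard ≤ n) :
    leftCost P α + midCost α + rightCost P α ≤ leftCost P A + midCost B + rightCost P C := by
  have hcard : (A ∪ B ∪ C).ncard ≤ n :=
    ((ncard_union_le _ _).trans (Nat.add_le_add_right (ncard_union_le _ _) _)).trans hn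
  have h := quantErr_le (P := P) ((hA.union hB).union hC) (hA'.inl.inl) hcard
  rw [← hα.2.2.2, distortion_eq hP, distortion_eq hP] at h
  have h1 : leftCost P (A ∪ B ∪ C) ≤ leftCost P A := leftCost_mono hP fun x _ _ =>
    infDist_sq_anti (subset_union_left.trans subset_union_left) hA' x
  have h2 : midCost (A ∪ B ∪ C) ≤ midCost B := midCost_mono fun x _ _ =>
    infDist_sq_anti (subset_union_right.trans subset_union_left) hB' x
  have h3 : rightCost P (A ∪ B ∪ C) ≤ rightCost P C := rightCost_mono hP fun x _ _ =>
    infDist_sq_anti subset_union_right hC' x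
  linarith

/-! ### Reflection in `1/2` -/

lemma IsCondensation.reflect (hP : IsCondensation P nuUnif) :
    IsCondensation (P.map (1 - ·)) nuUnif := by
  have hm : Measurable fun x : ℝ => 1 - x := by fun_prop
  have := hP.1
  refine ⟨Measure.isProbabilityMeasure_map hm.aemeasurable, ?_⟩
  have h1 : Measurable S1 := by unfold S1; fun_prop
  have h2 : Measurable S2 := by unfold S2; fun_prop
  have hν : nuUnif.map (1 - ·) = nuUnif := by
    rw [nuUnif, Measure.map_smul]
    congr 1
    have h := (Measure.measurePreserving_sub_left (volume : Measure ℝ) 1).restrict_preimage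
      (s := Icc (2 / 5 : ℝ) (3 / 5)) measurableSet_Icc
    have hs : (fun x : ℝ => 1 - x) ⁻¹' Icc (2 / 5 : ℝ) (3 / 5) = Icc (2 / 5) (3 / 5) := by
      rw [preimage_const_sub_Icc]; norm_num
    rw [hs] at h
    exact h.map_eq
  have e1 : (fun x : ℝ => 1 - x) ∘ S1 = S2 ∘ fun x => 1 - x := by
    ext x; simp only [S1, S2, Function.comp]; ring
  have e2 : (fun x : ℝ => 1 - x) ∘ S2 = S1 ∘ fun x => 1 - x := by
    ext x; simp only [S1, S2, Function.comp]; ring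
  conv_lhs => rw [hP.2]
  rw [Measure.map_add _ _ hm, Measure.map_add _ _ hm, Measure.map_smul, Measure.map_smul,
    Measure.map_smul, hν, Measure.map_map hm h1, Measure.map_map hm h2, e1, e2,
    ← Measure.map_map h2 hm, ← Measure.map_map h1 hm, add_comm (_ • Measure.map S2 _)]

lemma preimage_reflect_reflect (α : Set ℝ) :
    (fun x : ℝ => 1 - x) ⁻¹' ((fun x : ℝ => 1 - x) ⁻¹' α) = α := by
  ext x; simp

lemma finite_reflect (hf : α.Finite) : ((fun x : ℝ => 1 - x) ⁻¹' α).Finite :=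
  hf.preimage (sub_right_injective.injOn)

lemma nonempty_reflect (hne : α.Nonempty) : ((fun x : ℝ => 1 - x) ⁻¹' α).Nonempty :=
  hne.preimage fun y => ⟨1 - y, by ring⟩

lemma ncard_reflect (α : Set ℝ) : ((fun x : ℝ => 1 - x) ⁻¹' α).ncard = α.ncard :=
  ncard_preimage_of_injective_subset_range sub_right_injective
    fun y _ => ⟨1 - y, by ring⟩

lemma distortion_reflect (P : Measure ℝ) (α : Set ℝ) :
    distortion (P.map (1 - ·)) ((fun x : ℝ => 1 - x) ⁻¹' α) = distortion P α := by
  unfold distortion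
  rw [integral_map (by fun_prop) (continuous_infDist_sq _).aestronglyMeasurable]
  congr 1; ext x
  rw [← infDist_one_sub, sub_sub_cancel]

lemma leftCost_reflect (P : Measure ℝ) (α : Set ℝ) :
    leftCost (P.map (1 - ·)) ((fun x : ℝ => 1 - x) ⁻¹' α) = rightCost P α := by
  unfold leftCost rightCost
  have hc : Continuous fun y : ℝ => infDist (y / 5) ((fun x : ℝ => 1 - x) ⁻¹' α) ^ 2 :=
    (continuous_infDist_sq _).comp (by fun_prop)
  rw [integral_map (by fun_prop) hc.aestronglyMeasurable]
  congr 1; ext x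
  rw [← infDist_one_sub]
  congr 2; ring

lemma quantErr_reflect (P : Measure ℝ) (n : ℕ) :
    quantErr (P.map (1 - ·)) n = quantErr P n := by
  unfold quantErr
  congr 1; ext e
  constructor
  · rintro ⟨α, hf, hne, hc, rfl⟩
    refine ⟨_, finite_reflect hf, nonempty_reflect hne, (ncard_reflect α).trans_le hc, ?_⟩
    rw [← distortion_reflect P, preimage_reflect_reflect]
  · rintro ⟨α, hf, hne, hc, rfl⟩
    exact ⟨_, finite_reflect hf, nonempty_reflect hne, (ncard_reflect α).trans_le hc,
      (distortion_reflect P α).symm⟩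

lemma IsOptimalSet.reflect (hα : IsOptimalSet P n α) :
    IsOptimalSet (P.map (1 - ·)) n ((fun x : ℝ => 1 - x) ⁻¹' α) :=
  ⟨finite_reflect hα.1, nonempty_reflect hα.2.1, (ncard_reflect α).trans_le hα.2.2.1,
    (distortion_reflect P α).trans (hα.2.2.2.trans (quantErr_reflect P n).symm)⟩

lemma reflect_subset_Icc (h : α ⊆ Icc 0 1) : (fun x : ℝ => 1 - x) ⁻¹' α ⊆ Icc 0 1 := by
  intro x hx
  have := h hx
  constructor <;> linarith [this.1, this.2]

/-! ### Modifying optimal sets -/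

lemma distortion_mono (hP : IsCondensation P nuUnif)
    (h : ∀ x, 0 ≤ x → x ≤ 1 → infDist x α ^ 2 ≤ infDist x β ^ 2) :
    distortion P α ≤ distortion P β := by
  refine integral_mono_ae (hP.integrable (continuous_infDist_sq α))
    (hP.integrable (continuous_infDist_sq β)) ?_
  filter_upwards [hP.ae_mem_Icc] with y hy using h _ hy.1 hy.2

/-- Clamping an optimal set to `[0, 1]` gives an optimal set. -/
lemma IsOptimalSet.clamp (hP : IsCondensation P nuUnif) (hα : IsOptimalSet P n α) :
    IsOptimalSet P n ((fun x => max 0 (min x 1)) '' α) := by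
  have hf := hα.1.image fun x : ℝ => max 0 (min x 1)
  have hne := hα.2.1.image fun x : ℝ => max 0 (min x 1)
  have hc := (ncard_image_le (f := fun x : ℝ => max 0 (min x 1)) hα.1).trans hα.2.2.1
  refine ⟨hf, hne, hc, le_antisymm ?_ (quantErr_le hf hne hc)⟩
  rw [← hα.2.2.2]
  refine distortion_mono hP fun x h0 h1 =>
    infDist_sq_le_infDist_sq hα.1 hα.2.1 fun g hg => ⟨_, mem_image_of_mem _ hg, ?_⟩
  rcases le_total g 1 with h | h
  · rw [min_eq_left h]
    rcases le_total 0 g with h' | h'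
    · rw [max_eq_right h']
    · rw [max_eq_left h']; nlinarith
  · rw [min_eq_right h, max_eq_right zero_le_one]; nlinarith

/-- A set with fewer than `n` points is not optimal. -/
lemma quantErr_lt_distortion (hP : IsCondensation P nuUnif) (hf : β.Finite) (hne : β.Nonempty)
    (hc : β.ncard < n) : quantErr P n < distortion P β := by
  obtain ⟨x₀, hx₀, hxβ⟩ :=
    (Ioo_infinite (show (2 / 5 : ℝ) < 3 / 5 by norm_num)).exists_notMem_finite hf
  have hle := quantErr_le (P := P) (n := n) (hf.insert x₀) (insert_nonempty x₀ β)
    ((ncard_insert_le _ _).trans hc)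
  refine lt_of_le_of_ne (hle.trans (distortion_mono hP fun x _ _ =>
    infDist_sq_anti (subset_insert _ _) hne x)) fun heq => ?_
  have hmono : ∀ x, infDist x (insert x₀ β) ^ 2 ≤ infDist x β ^ 2 :=
    fun x => infDist_sq_anti (subset_insert _ _) hne x
  have hd : distortion P (insert x₀ β) = distortion P β :=
    le_antisymm (distortion_mono hP fun x _ _ => hmono x) (heq ▸ hle)
  have hae := (integral_eq_iff_of_ae_le (hP.integrable (continuous_infDist_sq (insert x₀ β)))
    (hP.integrable (continuous_infDist_sq β)) (Eventually.of_forall hmono)).1 hd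
  set U : Set ℝ := {x | infDist x (insert x₀ β) ^ 2 < infDist x β ^ 2} ∩ Ioo (2 / 5) (3 / 5)
  have hU : IsOpen U :=
    (isOpen_lt (continuous_infDist_sq _) (continuous_infDist_sq _)).inter isOpen_Ioo
  have hxU : x₀ ∈ U := by
    refine ⟨?_, hx₀⟩
    have := (hf.isClosed.notMem_iff_infDist_pos hne).1 hxβ
    change infDist x₀ (insert x₀ β) ^ 2 < infDist x₀ β ^ 2
    rw [infDist_zero_of_mem (mem_insert _ _)]
    simpa using pow_pos this 2
  have hPU : P U = 0 := measure_mono_null (fun x hx => hx.1.ne) hae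
  rw [hP.apply hU.measurableSet, add_eq_zero, nuUnif, Measure.smul_apply,
    Measure.restrict_apply hU.measurableSet,
    inter_eq_left.2 (inter_subset_right.trans Ioo_subset_Icc_self)] at hPU
  have := (hU.measure_pos volume ⟨_, hxU⟩).ne'
  exact this (by simpa [U] using hPU.2)

/-- If `b` serves the whole cell of `a` strictly better than `a`, the set is not optimal. -/
lemma IsOptimalSet.not_improvable (hP : IsCondensation P nuUnif) (hα : IsOptimalSet P n α)
    {a b : ℝ} (ha : a ∈ α) (hne : (α \ {a}).Nonempty)
    (h : ∀ x, 0 ≤ x → x ≤ 1 → ¬ (1 / 5 < x ∧ x < 2 / 5) →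
      (x - b) ^ 2 < (x - a) ^ 2 ∨ ∃ g ∈ α \ {a}, (x - g) ^ 2 ≤ (x - a) ^ 2) : False := by
  have hf : (α \ {a}).Finite := hα.1.sdiff
  have hlt : (α \ {a}).ncard < n := (ncard_sdiff_singleton_lt_of_mem ha hα.1).trans_le hα.2.2.1
  have hK : ∀ᵐ x ∂P, (0 ≤ x ∧ x ≤ 1) ∧ ¬ (1 / 5 < x ∧ x < 2 / 5) := by
    filter_upwards [hP.ae_mem_Icc, compl_mem_ae_iff.2 hP.measure_gap] with x hx hx'
    exact ⟨hx, hx'⟩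
  have hsplit : ∀ x, (∃ g ∈ α \ {a}, (x - g) ^ 2 ≤ (x - a) ^ 2) →
      infDist x (α \ {a}) ^ 2 ≤ infDist x α ^ 2 := fun x hx =>
    infDist_sq_le_infDist_sq hα.1 hα.2.1 fun g hg => by
      by_cases hga : g = a
      · exact hga ▸ hx
      · exact ⟨g, ⟨hg, hga⟩, le_rfl⟩
  have hmono : (fun x => infDist x (insert b (α \ {a})) ^ 2) ≤ᵐ[P] fun x => infDist x α ^ 2 := by
    filter_upwards [hK] with x hx
    rcases h x hx.1.1 hx.1.2 hx.2 with hb | hg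
    · refine infDist_sq_le_infDist_sq hα.1 hα.2.1 fun g hg => ?_
      by_cases hga : g = a
      · exact ⟨b, mem_insert _ _, hga ▸ hb.le⟩
      · exact ⟨g, mem_insert_of_mem _ ⟨hg, hga⟩, le_rfl⟩
    · exact (infDist_sq_anti (subset_insert _ _) hne x).trans (hsplit x hg)
  have hi := fun γ : Set ℝ => hP.integrable (continuous_infDist_sq γ)
  have hle := quantErr_le (P := P) (hf.insert b) (insert_nonempty _ _)
    ((ncard_insert_le _ _).trans hlt)
  rw [← hα.2.2.2] at hle
  have hae := (integral_eq_iff_of_ae_le (hi _) (hi _) hmono).1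
    (le_antisymm (integral_mono_ae (hi _) (hi _) hmono) hle)
  have hcost : distortion P (α \ {a}) ≤ distortion P α := by
    refine integral_mono_ae (hi _) (hi _) ?_
    filter_upwards [hK, hae] with x hx hxe
    refine hsplit x ?_
    rcases h x hx.1.1 hx.1.2 hx.2 with hb | hg
    · by_contra! hcon
      obtain ⟨g, hg, hgx⟩ := exists_infDist_sq_eq hα.1 hα.2.1 x
      have hga : g = a := by
        by_contra hga
        have h1 := infDist_sq_le (x := x) ha
        have h2 := hcon g ⟨hg, hga⟩
        linarith
      subst hga
      have h1 := infDist_sq_le (x := x) (mem_insert b (α \ {g}))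
      linarith
    · exact hg
  exact absurd hcost (not_le.2 (hα.2.2.2 ▸ quantErr_lt_distortion hP hf hne hlt))

/-! ### Estimates for the three parts -/

lemma continuous_infDist_comp_sq (α : Set ℝ) {φ : ℝ → ℝ} (hφ : Continuous φ) :
    Continuous fun y : ℝ => infDist (φ y) α ^ 2 :=
  (continuous_infDist_sq α).comp hφ

lemma leftCost_singleton_le (hP : IsCondensation P nuUnif) :
    leftCost P {1 / 10} ≤ 97 / 21900 := by
  have h := hP.integral_le_quadratic (a := 1 / 25) (b := -1 / 25) (c := 1 / 100)
    (continuous_infDist_comp_sq {1 / 10} (φ := fun y => y / 5) (by fun_prop)) fun x _ _ =>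
    (infDist_sq_le (mem_singleton _)).trans (by apply le_of_eq; ring)
  unfold leftCost
  linarith

lemma midCost_singleton_le : midCost {1 / 2} ≤ 1 / 300 := by
  have h := integral_le_quadratic (u := 2 / 5) (v := 3 / 5) (a := 1) (b := -1) (c := 1 / 4)
    (by norm_num) (continuous_infDist_sq {1 / 2}) fun x _ _ =>
    (infDist_sq_le (mem_singleton _)).trans (by apply le_of_eq; ring)
  unfold midCost
  linarith

lemma integral_split {F : ℝ → ℝ} (hF : Continuous F) (c : ℝ) :
    ∫ x in (2 / 5)..(3 / 5), F x = (∫ x in (2 / 5)..c, F x) + ∫ x in c..(3 / 5), F x :=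
  (intervalIntegral.integral_add_adjacent_intervals (hF.intervalIntegrable _ _)
    (hF.intervalIntegrable _ _)).symm

lemma midCost_pair_le : midCost {9 / 20, 11 / 20} ≤ 1 / 1200 := by
  have hc := continuous_infDist_sq {9 / 20, 11 / 20}
  have h1 := integral_le_quadratic (u := 2 / 5) (v := 1 / 2) (a := 1) (b := -9 / 10)
    (c := 81 / 400) (by norm_num) hc fun x _ _ =>
    (infDist_sq_le (g := 9 / 20) (by simp)).trans (by apply le_of_eq; ring)
  have h2 := integral_le_quadratic (u := 1 / 2) (v := 3 / 5) (a := 1) (b := -11 / 10)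
    (c := 121 / 400) (by norm_num) hc fun x _ _ =>
    (infDist_sq_le (g := 11 / 20) (by simp)).trans (by apply le_of_eq; ring)
  rw [midCost, integral_split hc (1 / 2)]
  linarith

lemma leftCost_pair_le (hP : IsCondensation P nuUnif) :
    leftCost P {13 / 300, 47 / 300} ≤ 61 / 50000 := by
  set A : Set ℝ := {13 / 300, 47 / 300} with hA
  have hc := continuous_infDist_comp_sq A (φ := fun y => y / 5) (by fun_prop)
  have m1 : 13 / 300 ∈ A := by simp [hA]
  have m2 : 47 / 300 ∈ A := by simp [hA]
  have h1 := hP.integral_le_quadratic (a := 1 / 625) (b := -13 / 3750) (c := 169 / 90000)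
    (continuous_infDist_comp_sq A (φ := fun y => y / 5 / 5) (by fun_prop)) fun x _ _ =>
    (infDist_sq_le m1).trans (by apply le_of_eq; ring)
  have h2 := integral_le_quadratic (u := 2 / 5) (v := 1 / 2) (a := 1 / 25) (b := -13 / 750)
    (c := 169 / 90000) (by norm_num) hc fun x _ _ =>
    (infDist_sq_le m1).trans (by apply le_of_eq; ring)
  have h3 := integral_le_quadratic (u := 1 / 2) (v := 3 / 5) (a := 1 / 25) (b := -47 / 750)
    (c := 2209 / 90000) (by norm_num) hc fun x _ _ =>
    (infDist_sq_le m2).trans (by apply le_of_eq; ring)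
  have h4 := hP.integral_le_quadratic (a := 1 / 625) (b := 1 / 3750) (c := 1 / 90000)
    (continuous_infDist_comp_sq A (φ := fun y => (y / 5 + 4 / 5) / 5) (by fun_prop)) fun x _ _ =>
    (infDist_sq_le m2).trans (by apply le_of_eq; ring)
  rw [leftCost, hP.integral_eq hc, integral_split hc (1 / 2)]
  linarith

lemma le_leftCost_of_three_tenths_le (hP : IsCondensation P nuUnif) (hf : α.Finite)
    (hne : α.Nonempty) (h : ∀ g ∈ α, 3 / 10 ≤ g) : 1 / 25 ≤ leftCost P α := by
  have h1 := hP.quadratic_le_integral (a := 1 / 25) (b := -3 / 25) (c := 9 / 100)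
    (continuous_infDist_comp_sq α (φ := fun y => y / 5) (by fun_prop)) fun x _ _ =>
    le_infDist_sq hf hne fun g hg => by nlinarith [h g hg]
  unfold leftCost
  linarith

/-- Lower bound when the points near the left part stay in its left half. -/
lemma le_leftCost_of_le_tenth (hP : IsCondensation P nuUnif) (hf : α.Finite)
    (hne : α.Nonempty) (h : ∀ g ∈ α, g ≤ 1 / 10 ∨ 3 / 10 ≤ g) : 219 / 100000 ≤ leftCost P α := by
  have hc := continuous_infDist_comp_sq α (φ := fun y => y / 5) (by fun_prop)
  have h1 : 0 ≤ ∫ y, infDist (y / 5 / 5) α ^ 2 ∂P := integral_nonneg fun _ => by positivity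
  have h2 : 0 ≤ ∫ x in (2 / 5)..(3 / 5), infDist (x / 5) α ^ 2 :=
    intervalIntegral.integral_nonneg (by norm_num) fun _ _ => by positivity
  have h3 := hP.quadratic_le_integral (a := 1 / 625) (b := 3 / 625) (c := 9 / 2500)
    (continuous_infDist_comp_sq α (φ := fun y => (y / 5 + 4 / 5) / 5) (by fun_prop)) fun x _ _ =>
    le_infDist_sq hf hne fun g hg => by
      rcases h g hg with hg | hg <;> nlinarith
  rw [leftCost, hP.integral_eq hc]
  linarith

/-- Lower bound when a single point serves most of the left part. -/
lemma le_leftCost_of_single (hP : IsCondensation P nuUnif) (hf : α.Finite)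
    (hne : α.Nonempty) {p : ℝ} (h0 : 0 ≤ p) (h1 : p ≤ 1 / 10)
    (h : ∀ g ∈ α, g = p ∨ 3 / 10 ≤ g) : 97 / 21900 - 3 / 5000 ≤ leftCost P α := by
  have hc := continuous_infDist_comp_sq α (φ := fun y => y / 5) (by fun_prop)
  have hc' := continuous_infDist_comp_sq α (φ := fun y => (y / 5 + 4 / 5) / 5) (by fun_prop)
  have e1 := hP.quadratic_le_integral (a := 1 / 625) (b := -2 / 25 * p) (c := p ^ 2)
    (continuous_infDist_comp_sq α (φ := fun y => y / 5 / 5) (by fun_prop)) fun x _ _ =>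
    le_infDist_sq hf hne fun g hg => by
      rcases h g hg with rfl | hg
      · apply le_of_eq; ring
      · nlinarith
  have e2 := quadratic_le_integral (u := 2 / 5) (v := 3 / 5) (a := 1 / 25) (b := -2 / 5 * p)
    (c := p ^ 2) (by norm_num) hc fun x _ _ =>
    le_infDist_sq hf hne fun g hg => by
      rcases h g hg with rfl | hg
      · apply le_of_eq; ring
      · nlinarith
  have e3 := hP.quadratic_le_integral (a := 1 / 15625) (b := 3 / 3125)
    (c := 9 / 2500 + 12 / 100 * (1 / 10 - p))
    (continuous_infDist_comp_sq α (φ := fun y => (y / 5 / 5 + 4 / 5) / 5) (by fun_prop))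
    fun x _ _ => le_infDist_sq hf hne fun g hg => by
      rcases h g hg with rfl | hg <;> nlinarith
  have e4 := quadratic_le_integral (u := 2 / 5) (v := 3 / 5) (a := 1 / 625) (b := 3 / 625)
    (c := 9 / 2500) (by norm_num) hc' fun x _ _ =>
    le_infDist_sq hf hne fun g hg => by
      rcases h g hg with rfl | hg <;> nlinarith
  have e5 := hP.quadratic_le_integral (a := 1 / 15625) (b := 23 / 15625) (c := 529 / 62500)
    (continuous_infDist_comp_sq α (φ := fun y => ((y / 5 + 4 / 5) / 5 + 4 / 5) / 5)
      (by fun_prop)) fun x _ _ =>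
    le_infDist_sq hf hne fun g hg => by
      rcases h g hg with rfl | hg <;> nlinarith
  rw [leftCost, hP.integral_eq hc, hP.integral_eq hc']
  nlinarith [sq_nonneg (p - 7 / 100)]

/-- The points serving the left part, when no point of `α` beyond `3/10` does. -/
lemma leftCost_inter_Iio_le (hP : IsCondensation P nuUnif) (hf : α.Finite) (hne : α.Nonempty)
    (h : ∀ q ∈ α, 3 / 10 ≤ q → ∃ p ∈ α, p < 3 / 10 ∧ 2 / 5 ≤ p + q) :
    leftCost P (α ∩ Iio (3 / 10)) ≤ leftCost P α :=
  leftCost_mono hP fun x _ _ => infDist_sq_le_infDist_sq hf hne fun g hg => by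
    rcases lt_or_ge g (3 / 10) with hg' | hg'
    · exact ⟨g, ⟨hg, hg'⟩, le_rfl⟩
    · obtain ⟨p, hp, hp', hpq⟩ := h g hg hg'
      exact ⟨p, ⟨hp, hp'⟩, by nlinarith⟩

/-- A set of points below `3/10` can be rearranged so as to serve the left part alone, at a cost
of at most `3/5000`. -/
lemma exists_leftCost_le (hP : IsCondensation P nuUnif) (hf : α.Finite) (hI : α ⊆ Icc 0 1)
    (hne : (α ∩ Iio (3 / 10)).Nonempty) :
    ∃ A : Set ℝ, A.Finite ∧ A.Nonempty ∧ A.ncard ≤ (α ∩ Iio (3 / 10)).ncard ∧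
      (leftCost P A ≤ leftCost P α ∨ leftCost P A ≤ leftCost P α + 3 / 5000 ∧
        ∃ q ∈ α, 3 / 10 ≤ q ∧ ∀ p ∈ α, p < 3 / 10 → p + q < 2 / 5) := by
  have hne' : α.Nonempty := hne.left
  have hfG : (α ∩ Iio (3 / 10)).Finite := hf.inter_of_left _
  by_cases h : ∀ q ∈ α, 3 / 10 ≤ q → ∃ p ∈ α, p < 3 / 10 ∧ 2 / 5 ≤ p + q
  · exact ⟨_, hfG, hne, le_rfl, Or.inl (leftCost_inter_Iio_le hP hf hne' h)⟩
  push Not at h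
  obtain ⟨q, hq, hq3, h⟩ := h
  rcases Nat.lt_or_ge (α ∩ Iio (3 / 10)).ncard 2 with hn | hn
  · have hpos := (ncard_pos hfG).2 hne
    obtain ⟨p, hp⟩ := ncard_eq_one.1 (show (α ∩ Iio (3 / 10)).ncard = 1 by omega)
    have hpm : p ∈ α ∩ Iio (3 / 10) := hp ▸ mem_singleton p
    have hcost := le_leftCost_of_single hP hf hne' (hI hpm.1).1
      (by linarith [h p hpm.1 hpm.2]) fun g hg => by
        rcases lt_or_ge g (3 / 10) with hg' | hg'
        · left
          have : g ∈ α ∩ Iio (3 / 10) := ⟨hg, hg'⟩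
          rwa [hp] at this
        · exact Or.inr hg'
    refine ⟨{1 / 10}, finite_singleton _, singleton_nonempty _, ?_, Or.inr ⟨?_, q, hq, hq3, h⟩⟩
    · rw [ncard_singleton]; omega
    · linarith [leftCost_singleton_le hP]
  · refine ⟨{13 / 300, 47 / 300}, by simp, by simp, ?_, Or.inl ?_⟩
    · exact (ncard_insert_le _ _).trans (by simpa using hn)
    have := le_leftCost_of_le_tenth hP hf hne' fun g hg => by
      rcases lt_or_ge g (3 / 10) with hg' | hg'
      · left; linarith [h g hg hg']
      · exact Or.inr hg'
    linarith [leftCost_pair_le hP]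

/-- The bump `max 0 (r² - (x - g)²)` has integral at most `4 r³ / 3`. -/
lemma integral_bump_le {g r u v : ℝ} (hr : 0 ≤ r) (huv : u ≤ v) :
    ∫ x in u..v, max 0 (r ^ 2 - (x - g) ^ 2) ≤ 4 / 3 * r ^ 3 := by
  have hc : Continuous fun x : ℝ => max 0 (r ^ 2 - (x - g) ^ 2) := by fun_prop
  have hb := fun a b : ℝ => hc.intervalIntegrable (μ := volume) a b
  have hsub : ∫ x in u..v, max 0 (r ^ 2 - (x - g) ^ 2) ≤
      ∫ x in (min u (g - r))..(max v (g + r)), max 0 (r ^ 2 - (x - g) ^ 2) :=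
    intervalIntegral.integral_mono_interval (min_le_left _ _) huv (le_max_left _ _)
      (Eventually.of_forall fun x => le_max_left _ _) (hb _ _)
  have hadj := intervalIntegral.integral_add_adjacent_intervals
    (hb (min u (g - r)) (g - r)) (hb (g - r) (max v (g + r)))
  have hadj' := intervalIntegral.integral_add_adjacent_intervals
    (hb (g - r) (g + r)) (hb (g + r) (max v (g + r)))
  have h1 := integral_le_quadratic (u := min u (g - r)) (v := g - r) (a := 0) (b := 0) (c := 0)
    (min_le_right _ _) hc fun x _ hx => by
      have : r ^ 2 - (x - g) ^ 2 ≤ 0 := by nlinarith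
      simp [this]
  have h2 := integral_le_quadratic (u := g - r) (v := g + r) (a := -1) (b := 2 * g)
    (c := r ^ 2 - g ^ 2) (by linarith) hc fun x hx hx' => by
      have : 0 ≤ r ^ 2 - (x - g) ^ 2 := by nlinarith
      rw [max_eq_right this]; apply le_of_eq; ring
  have h3 := integral_le_quadratic (u := g + r) (v := max v (g + r)) (a := 0) (b := 0) (c := 0)
    (le_max_right _ _) hc fun x hx _ => by
      have : r ^ 2 - (x - g) ^ 2 ≤ 0 := by nlinarith
      simp [this]
  have e2 : -1 * ((g + r) ^ 3 - (g - r) ^ 3) / 3 + 2 * g * ((g + r) ^ 2 - (g - r) ^ 2) / 2 +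
      (r ^ 2 - g ^ 2) * (g + r - (g - r)) = 4 / 3 * r ^ 3 := by ring
  linarith

lemma le_midCost_of_le (hf : α.Finite) (hne : α.Nonempty) (h : ∀ g ∈ α, g ≤ 2 / 5) :
    4 / 300 ≤ midCost α := by
  have h1 := quadratic_le_integral (u := 2 / 5) (v := 3 / 5) (a := 1) (b := -4 / 5)
    (c := 4 / 25) (by norm_num) (continuous_infDist_sq α) fun x hx _ =>
    le_infDist_sq hf hne fun g hg => by nlinarith [h g hg]
  unfold midCost
  linarith

lemma le_midCost_of_two (hf : α.Finite) (hne : α.Nonempty) {k : ℝ}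
    (h : ∀ g ∈ α, g ≤ 2 / 5 ∨ g = k) : 1 / 675 ≤ midCost α := by
  have hc := continuous_infDist_sq α
  have hb : Continuous fun x : ℝ => max 0 ((1 / 15 : ℝ) ^ 2 - (x - k) ^ 2) := by fun_prop
  have hs : Continuous fun x : ℝ => infDist x α ^ 2 + max 0 ((1 / 15 : ℝ) ^ 2 - (x - k) ^ 2) :=
    hc.add hb
  have h1 := quadratic_le_integral (u := 2 / 5) (v := 7 / 15) (a := 1) (b := -4 / 5)
    (c := 4 / 25) (by norm_num) hs fun x hx hx' => by
      have h0 := le_max_left 0 ((1 / 15 : ℝ) ^ 2 - (x - k) ^ 2)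
      have h1 := le_max_right 0 ((1 / 15 : ℝ) ^ 2 - (x - k) ^ 2)
      rw [← sub_le_iff_le_add]
      refine le_infDist_sq hf hne fun g hg => ?_
      rcases h g hg with hg | rfl
      · nlinarith
      · nlinarith
  have h2 := quadratic_le_integral (u := 7 / 15) (v := 3 / 5) (a := 0) (b := 0)
    (c := 1 / 225) (by norm_num) hs fun x hx hx' => by
      have h0 := le_max_left 0 ((1 / 15 : ℝ) ^ 2 - (x - k) ^ 2)
      have h1 := le_max_right 0 ((1 / 15 : ℝ) ^ 2 - (x - k) ^ 2)
      rw [← sub_le_iff_le_add]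
      refine le_infDist_sq hf hne fun g hg => ?_
      rcases h g hg with hg | rfl
      · nlinarith
      · nlinarith
  have h3 : ∫ x in (2 / 5)..(3 / 5), (infDist x α ^ 2 + max 0 ((1 / 15 : ℝ) ^ 2 - (x - k) ^ 2)) =
      (∫ x in (2 / 5)..(3 / 5), infDist x α ^ 2) +
        ∫ x in (2 / 5)..(3 / 5), max 0 ((1 / 15 : ℝ) ^ 2 - (x - k) ^ 2) :=
    intervalIntegral.integral_add (hc.intervalIntegrable _ _) (hb.intervalIntegrable _ _)
  rw [integral_split hs (7 / 15)] at h3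
  have h4 := integral_bump_le (g := k) (r := 1 / 15) (u := 2 / 5) (v := 3 / 5) (by norm_num)
    (by norm_num)
  unfold midCost
  linarith

/-- Lower bound when no point serves the left half of the middle part well. -/
lemma le_midCost_of_half_le (hf : α.Finite) (hne : α.Nonempty)
    (h : ∀ g ∈ α, g ≤ 3 / 10 ∨ 1 / 2 ≤ g) : 1 / 600 ≤ midCost α := by
  have hc := continuous_infDist_sq α
  have h1 := quadratic_le_integral (u := 2 / 5) (v := 1 / 2) (a := 1) (b := -1)
    (c := 1 / 4) (by norm_num) hc fun x hx hx' =>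
    le_infDist_sq hf hne fun g hg => by
      rcases h g hg with hg | hg <;> nlinarith
  have h2 : 0 ≤ ∫ x in (1 / 2)..(3 / 5), infDist x α ^ 2 :=
    intervalIntegral.integral_nonneg (by norm_num) fun _ _ => by positivity
  rw [midCost, integral_split hc (1 / 2)]
  linarith

lemma le_midCost_of_single (hf : α.Finite) (hne : α.Nonempty) {v : ℝ} (h0 : 0 ≤ v)
    (h1 : v ≤ 1 / 5) (h : ∀ g ∈ α, g ≤ 3 / 10 ∨ g = 1 / 2 + v ∨ 7 / 10 ≤ g) :
    1 / 300 + v ^ 2 / 2 ≤ midCost α := by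
  have hc := continuous_infDist_sq α
  have e1 := quadratic_le_integral (u := 2 / 5) (v := 2 / 5 + v / 2) (a := 1) (b := -3 / 5)
    (c := 9 / 100) (by linarith) hc fun x hx hx' =>
    le_infDist_sq hf hne fun g hg => by
      rcases h g hg with hg | rfl | hg <;> nlinarith
  have e2 := quadratic_le_integral (u := 2 / 5 + v / 2) (v := 3 / 5) (a := 1)
    (b := -2 * (1 / 2 + v)) (c := (1 / 2 + v) ^ 2) (by linarith) hc fun x hx hx' =>
    le_infDist_sq hf hne fun g hg => by
      rcases h g hg with hg | rfl | hg
      · nlinarith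
      · apply le_of_eq; ring
      · nlinarith
  rw [midCost, integral_split hc (2 / 5 + v / 2)]
  nlinarith [mul_nonneg (sq_nonneg v) (sub_nonneg.2 h1)]

lemma le_midCost_of_gap (hf : α.Finite) (hne : α.Nonempty)
    (h : ∀ g ∈ α, g ≤ 3 / 10 ∨ 7 / 10 ≤ g) : 1 / 50 ≤ midCost α := by
  have hc := continuous_infDist_sq α
  have h1 := quadratic_le_integral (u := 2 / 5) (v := 1 / 2) (a := 1) (b := -3 / 5)
    (c := 9 / 100) (by norm_num) hc fun x hx hx' =>
    le_infDist_sq hf hne fun g hg => by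
      rcases h g hg with hg | hg <;> nlinarith
  have h2 := quadratic_le_integral (u := 1 / 2) (v := 3 / 5) (a := 1) (b := -7 / 5)
    (c := 49 / 100) (by norm_num) hc fun x hx hx' =>
    le_infDist_sq hf hne fun g hg => by
      rcases h g hg with hg | hg <;> nlinarith
  rw [midCost, integral_split hc (1 / 2)]
  linarith

/-! ### Distribution of the points of an optimal set -/

lemma rightCost_singleton_le (hP : IsCondensation P nuUnif) :
    rightCost P {9 / 10} ≤ 97 / 21900 := by
  have h : (fun x : ℝ => 1 - x) ⁻¹' {9 / 10} = {1 / 10} := by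
    ext x
    simp only [mem_preimage, mem_singleton_iff]
    constructor <;> intro h <;> linarith
  rw [← leftCost_reflect, h]
  exact leftCost_singleton_le hP.reflect

lemma ncard_three_parts (hf : α.Finite) :
    (α ∩ Iio (3 / 10)).ncard + (α ∩ Icc (3 / 10) (7 / 10)).ncard +
      (α ∩ Ioi (7 / 10)).ncard ≤ α.ncard := by
  have h1 : Disjoint (α ∩ Iio (3 / 10)) (α ∩ Icc (3 / 10) (7 / 10)) :=
    disjoint_left.2 fun x hx hx' => not_lt_of_ge hx'.2.1 hx.2
  have h2 : Disjoint (α ∩ Iio (3 / 10) ∪ α ∩ Icc (3 / 10) (7 / 10)) (α ∩ Ioi (7 / 10)) := by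
    refine disjoint_left.2 fun x hx hx' => ?_
    have h3 : 7 / 10 < x := hx'.2
    rcases hx with hx | hx
    · have h4 : x < 3 / 10 := hx.2
      linarith
    · linarith [hx.2.2]
  rw [← ncard_union_eq h1 (hf.inter_of_left _) (hf.inter_of_left _),
    ← ncard_union_eq h2 ((hf.inter_of_left _).union (hf.inter_of_left _)) (hf.inter_of_left _)]
  exact ncard_le_ncard
    (union_subset (union_subset inter_subset_left inter_subset_left) inter_subset_left) hf

lemma IsOptimalSet.cost_le_of_three_le (hP : IsCondensation P nuUnif) (hα : IsOptimalSet P n α)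
    (hn : 3 ≤ n) :
    leftCost P α + midCost α + rightCost P α ≤ 97 / 21900 + 1 / 300 + 97 / 21900 := by
  have h := hα.cost_le hP (finite_singleton (1 / 10)) (singleton_nonempty _)
    (finite_singleton (1 / 2)) (singleton_nonempty _) (finite_singleton (9 / 10))
    (singleton_nonempty _) (by simpa using hn)
  linarith [leftCost_singleton_le hP, midCost_singleton_le, rightCost_singleton_le hP]

lemma IsOptimalSet.left_nonempty (hP : IsCondensation P nuUnif) (hα : IsOptimalSet P n α)
    (hn : 3 ≤ n) : (α ∩ Iio (3 / 10)).Nonempty := by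
  by_contra hne
  have h := le_leftCost_of_three_tenths_le hP hα.1 hα.2.1 fun g hg =>
    not_lt.1 fun hg' => hne ⟨g, hg, hg'⟩
  linarith [hα.cost_le_of_three_le hP hn, midCost_nonneg (α := α),
    rightCost_nonneg (P := P) (α := α)]

lemma reflect_inter_Iio (α : Set ℝ) : ((fun x : ℝ => 1 - x) ⁻¹' α) ∩ Iio (3 / 10) =
    (fun x : ℝ => 1 - x) ⁻¹' (α ∩ Ioi (7 / 10)) := by
  ext x
  simp only [mem_inter_iff, mem_preimage, mem_Iio, mem_Ioi]
  constructor <;> rintro ⟨h, h'⟩ <;> exact ⟨h, by linarith⟩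

lemma IsOptimalSet.right_nonempty (hP : IsCondensation P nuUnif) (hα : IsOptimalSet P n α)
    (hn : 3 ≤ n) : (α ∩ Ioi (7 / 10)).Nonempty := by
  have h := hα.reflect.left_nonempty hP.reflect hn
  rw [reflect_inter_Iio] at h
  obtain ⟨x, hx⟩ := h
  exact ⟨_, hx⟩

lemma IsOptimalSet.mid_nonempty (hP : IsCondensation P nuUnif) (hα : IsOptimalSet P n α)
    (hn : 3 ≤ n) : (α ∩ Icc (3 / 10) (7 / 10)).Nonempty := by
  by_contra hne
  have h := le_midCost_of_gap hα.1 hα.2.1 fun g hg => by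
    by_contra! hg'
    exact hne ⟨g, hg, hg'.1.le, hg'.2.le⟩
  linarith [hα.cost_le_of_three_le hP hn, leftCost_nonneg (P := P) (α := α),
    rightCost_nonneg (P := P) (α := α)]

/-- Mirror image of `exists_leftCost_le`. -/
lemma exists_rightCost_le (hP : IsCondensation P nuUnif) (hf : α.Finite) (hI : α ⊆ Icc 0 1)
    (hne : (α ∩ Ioi (7 / 10)).Nonempty) :
    ∃ C : Set ℝ, C.Finite ∧ C.Nonempty ∧ C.ncard ≤ (α ∩ Ioi (7 / 10)).ncard ∧
      (rightCost P C ≤ rightCost P α ∨ rightCost P C ≤ rightCost P α + 3 / 5000 ∧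
        ∃ q ∈ α, q ≤ 7 / 10 ∧ ∀ r ∈ α, 7 / 10 < r → 8 / 5 < r + q) := by
  obtain ⟨A, hA, hA', hc, h⟩ := exists_leftCost_le hP.reflect (finite_reflect hf)
    (reflect_subset_Icc hI) (by rw [reflect_inter_Iio]; exact nonempty_reflect hne)
  rw [reflect_inter_Iio, ncard_reflect] at hc
  refine ⟨_, finite_reflect hA, nonempty_reflect hA', (ncard_reflect A).trans_le hc, ?_⟩
  rw [leftCost_reflect] at h
  rw [← leftCost_reflect P, preimage_reflect_reflect]
  refine h.imp_right fun ⟨h, q, hq, hq', hp⟩ => ⟨h, 1 - q, hq, by linarith, fun r hr hr' => ?_⟩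
  have := hp (1 - r) (by simpa using hr) (by linarith)
  linarith

/-- Every left point lies closer to the left half of the middle part than some middle point. -/
lemma IsOptimalSet.exists_mid_add_le (hP : IsCondensation P nuUnif) (hα : IsOptimalSet P n α)
    (hn : 3 ≤ n) (hI : α ⊆ Icc 0 1) {p : ℝ} (hp : p ∈ α) (hp' : p < 3 / 10) :
    ∃ q ∈ α, 3 / 10 ≤ q ∧ q ≤ 7 / 10 ∧ p + q ≤ 4 / 5 := by
  by_contra! hq
  have hG := hα.mid_nonempty hP hn
  have hA := leftCost_inter_Iio_le hP hα.1 hα.2.1 fun q hqα hq3 => ⟨p, hp, hp', by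
    have := (hI hp).1
    rcases le_or_gt q (7 / 10) with h | h
    · linarith [hq q hqα hq3 h]
    · linarith⟩
  obtain ⟨C, hC, hC', hCc, hCr⟩ := exists_rightCost_le hP hα.1 hI (hα.right_nonempty hP hn)
  have hcard := (ncard_three_parts hα.1).trans hα.2.2.1
  have hGf : (α ∩ Icc (3 / 10) (7 / 10)).Finite := hα.1.inter_of_left _
  rcases lt_or_ge (α ∩ Icc (3 / 10) (7 / 10)).ncard 2 with h2 | h2
  · have h1 : (α ∩ Icc (3 / 10) (7 / 10)).ncard = 1 := by
      have := hG.ncard_pos hGf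
      omega
    obtain ⟨q, hGq⟩ := ncard_eq_one.1 h1
    have hqG : q ∈ α ∩ Icc (3 / 10) (7 / 10) := hGq ▸ mem_singleton q
    have hqp := hq q hqG.1 hqG.2.1 hqG.2.2
    have hm := le_midCost_of_single (v := q - 1 / 2) hα.1 hα.2.1 (by linarith)
      (by linarith [hqG.2.2]) fun g hg => by
        by_contra! hg'
        have : g ∈ α ∩ Icc (3 / 10) (7 / 10) := ⟨hg, hg'.1.le, hg'.2.2.le⟩
        rw [hGq, mem_singleton_iff] at this
        exact hg'.2.1 (by linarith)
    have hle := hα.cost_le hP (A := α ∩ Iio (3 / 10)) (hα.1.inter_of_left _) ⟨p, hp, hp'⟩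
      (finite_singleton (1 / 2)) (singleton_nonempty _) hC hC' (by rw [ncard_singleton]; omega)
    have hs := midCost_singleton_le
    rcases hCr with hCr | ⟨hCr, k, hk, hk', hkr⟩
    · nlinarith
    · obtain ⟨r, hr, hr'⟩ := hα.right_nonempty hP hn
      have hkr := hkr r hr hr'
      have hr1 := (hI hr).2
      have : k ∈ α ∩ Icc (3 / 10) (7 / 10) := ⟨hk, by linarith, hk'⟩
      rw [hGq, mem_singleton_iff] at this
      nlinarith
  · have hm := le_midCost_of_half_le hα.1 hα.2.1 fun g hg => by
      by_contra! hg'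
      linarith [hq g hg hg'.1.le (by linarith)]
    have hle := hα.cost_le hP (A := α ∩ Iio (3 / 10)) (hα.1.inter_of_left _) ⟨p, hp, hp'⟩
      (B := {9 / 20, 11 / 20}) (by simp) (by simp) hC hC'
      (by have := ncard_insert_le (9 / 20 : ℝ) {11 / 20}; rw [ncard_singleton] at this; omega)
    have hs := midCost_pair_le
    rcases hCr with hCr | ⟨hCr, -⟩ <;> linarith

lemma IsOptimalSet.exists_mid_le_add (hP : IsCondensation P nuUnif) (hα : IsOptimalSet P n α)
    (hn : 3 ≤ n) (hI : α ⊆ Icc 0 1) {r : ℝ} (hr : r ∈ α) (hr' : 7 / 10 < r) :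
    ∃ q ∈ α, 3 / 10 ≤ q ∧ q ≤ 7 / 10 ∧ 6 / 5 ≤ q + r := by
  obtain ⟨q, hq, h1, h2, h3⟩ := hα.reflect.exists_mid_add_le hP.reflect hn (reflect_subset_Icc hI)
    (p := 1 - r) (by simpa using hr) (by linarith)
  exact ⟨1 - q, hq, by linarith, by linarith, by linarith⟩

lemma IsOptimalSet.midCost_inter_le (hP : IsCondensation P nuUnif) (hα : IsOptimalSet P n α)
    (hn : 3 ≤ n) (hI : α ⊆ Icc 0 1) :
    midCost (α ∩ Icc (3 / 10) (7 / 10)) ≤ midCost α :=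
  midCost_mono fun x _ _ => infDist_sq_le_infDist_sq hα.1 hα.2.1 fun g hg => by
    rcases lt_or_ge g (3 / 10) with h | h
    · obtain ⟨q, hq, h1, h2, h3⟩ := hα.exists_mid_add_le hP hn hI hg h
      exact ⟨q, ⟨hq, h1, h2⟩, by nlinarith⟩
    rcases le_or_gt g (7 / 10) with h' | h'
    · exact ⟨g, ⟨hg, h, h'⟩, le_rfl⟩
    · obtain ⟨q, hq, h1, h2, h3⟩ := hα.exists_mid_le_add hP hn hI hg h'
      exact ⟨q, ⟨hq, h1, h2⟩, by nlinarith⟩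

/-- Every other point lies farther from the left part than some left point. -/
lemma IsOptimalSet.exists_left_le_add (hP : IsCondensation P nuUnif) (hα : IsOptimalSet P n α)
    (hn : 3 ≤ n) (hI : α ⊆ Icc 0 1) {q : ℝ} (hq : q ∈ α) (hq' : 3 / 10 ≤ q) :
    ∃ p ∈ α, p < 3 / 10 ∧ 2 / 5 ≤ p + q := by
  by_contra! h
  obtain ⟨p, hp, hp'⟩ := hα.left_nonempty hP hn
  rw [mem_Iio] at hp'
  have hq5 : q < 2 / 5 := by linarith [h p hp hp', (hI hp).1]
  have hqG : q ∈ α ∩ Icc (3 / 10) (7 / 10) := ⟨hq, hq', by linarith⟩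
  obtain ⟨C, hC, hC', hCc, hCr⟩ := exists_rightCost_le hP hα.1 hI (hα.right_nonempty hP hn)
  replace hCr : rightCost P C ≤ rightCost P α + 3 / 5000 := by
    rcases hCr with hCr | ⟨hCr, -⟩ <;> linarith
  have hcard := (ncard_three_parts hα.1).trans hα.2.2.1
  have hGf : (α ∩ Icc (3 / 10) (7 / 10)).Finite := hα.1.inter_of_left _
  have hLf : (α ∩ Iio (3 / 10)).Finite := hα.1.inter_of_left _
  have hpair := ncard_insert_le (13 / 300 : ℝ) {47 / 300}
  have hpair' := ncard_insert_le (9 / 20 : ℝ) {11 / 20}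
  rw [ncard_singleton] at hpair hpair'
  have hGm := hα.midCost_inter_le hP hn hI
  have hLp := leftCost_pair_le hP
  rcases lt_or_ge (α ∩ Iio (3 / 10)).ncard 2 with h2 | h2
  · have hL1 : (α ∩ Iio (3 / 10)).ncard = 1 := by
      have := (show (α ∩ Iio (3 / 10)).Nonempty from ⟨p, hp, hp'⟩).ncard_pos hLf
      omega
    obtain ⟨p', hLp'⟩ := ncard_eq_one.1 hL1
    have hlow := le_leftCost_of_single hP hα.1 hα.2.1 (hI hp).1
      (by linarith [h p hp hp']) fun g hg => by
        by_contra! hg'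
        have h1 : g ∈ α ∩ Iio (3 / 10) := ⟨hg, hg'.2⟩
        have h2 : p ∈ α ∩ Iio (3 / 10) := ⟨hp, hp'⟩
        rw [hLp', mem_singleton_iff] at h1 h2
        exact hg'.1 (h1.trans h2.symm)
    have hGpos := (show (α ∩ Icc (3 / 10) (7 / 10)).Nonempty from ⟨q, hqG⟩).ncard_pos hGf
    have hs := midCost_singleton_le
    rcases lt_trichotomy (α ∩ Icc (3 / 10) (7 / 10)).ncard 2 with hG | hG | hG
    · obtain ⟨k, hGk⟩ := ncard_eq_one.1
        (show (α ∩ Icc (3 / 10) (7 / 10)).ncard = 1 by omega)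
      have hm := le_midCost_of_le hGf ⟨q, hqG⟩ fun g hg => by
        rw [hGk, mem_singleton_iff] at hg hqG
        linarith
      have hle := hα.cost_le hP (finite_singleton (1 / 10)) (singleton_nonempty _)
        (finite_singleton (1 / 2)) (singleton_nonempty _) hC hC'
        (by rw [ncard_singleton, ncard_singleton]; omega)
      linarith [leftCost_singleton_le hP]
    · obtain ⟨k, l, -, hGk⟩ := ncard_eq_two.1 hG
      have hm : 1 / 675 ≤ midCost (α ∩ Icc (3 / 10) (7 / 10)) := by
        rw [hGk] at hqG
        rcases hqG with rfl | rfl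
        · refine le_midCost_of_two (k := l) hGf ⟨q, by simp [hGk]⟩ fun g hg => ?_
          rw [hGk] at hg
          rcases hg with rfl | hg
          · exact Or.inl hq5.le
          · exact Or.inr hg
        · refine le_midCost_of_two (k := k) hGf ⟨q, by simp [hGk]⟩ fun g hg => ?_
          rw [hGk] at hg
          rcases hg with hg | rfl
          · exact Or.inr hg
          · exact Or.inl hq5.le
      have hle := hα.cost_le hP (A := {13 / 300, 47 / 300}) (by simp) (by simp)
        (finite_singleton (1 / 2)) (singleton_nonempty _) hC hC'
        (by rw [ncard_singleton]; omega)
      linarith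
    · have hle := hα.cost_le hP (A := {13 / 300, 47 / 300}) (by simp) (by simp)
        (B := {9 / 20, 11 / 20}) (by simp) (by simp) hC hC' (by omega)
      linarith [midCost_pair_le, midCost_nonneg (α := α)]
  · have hlow := le_leftCost_of_le_tenth hP hα.1 hα.2.1 fun g hg => by
      by_contra! hg'
      linarith [h g hg hg'.2]
    have hle := hα.cost_le hP (A := {13 / 300, 47 / 300}) (by simp) (by simp) hGf ⟨q, hqG⟩
      hC hC' (by omega)
    linarith

lemma IsOptimalSet.notMem_left_gap_of_subset (hP : IsCondensation P nuUnif)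
    (hα : IsOptimalSet P n α) (hn : 3 ≤ n) (hI : α ⊆ Icc 0 1) {a : ℝ} (h1 : 1 / 5 < a)
    (h2 : a < 2 / 5) : a ∉ α := by
  intro ha
  rcases lt_or_ge a (3 / 10) with h | h
  · obtain ⟨q, hq, hq1, -, hq2⟩ := hα.exists_mid_add_le hP hn hI ha h
    have hqa : q ∈ α \ {a} := ⟨hq, fun e => by rw [mem_singleton_iff] at e; linarith⟩
    refine hα.not_improvable hP (b := 1 / 5) ha ⟨q, hqa⟩ fun x _ _ hx => ?_
    rcases le_or_gt x (1 / 5) with hx' | hx'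
    · left; nlinarith
    · have : 2 / 5 ≤ x := not_lt.1 fun h => hx ⟨hx', h⟩
      exact Or.inr ⟨q, hqa, by nlinarith⟩
  · obtain ⟨p, hp, hp1, hp2⟩ := hα.exists_left_le_add hP hn hI ha h
    have hpa : p ∈ α \ {a} := ⟨hp, fun e => by rw [mem_singleton_iff] at e; linarith⟩
    refine hα.not_improvable hP (b := 2 / 5) ha ⟨p, hpa⟩ fun x _ _ hx => ?_
    rcases le_or_gt x (1 / 5) with hx' | hx'
    · exact Or.inr ⟨p, hpa, by nlinarith⟩
    · have : 2 / 5 ≤ x := not_lt.1 fun h => hx ⟨hx', h⟩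
      left; nlinarith

lemma IsOptimalSet.notMem_left_gap (hP : IsCondensation P nuUnif) (hα : IsOptimalSet P n α)
    (hn : 3 ≤ n) {a : ℝ} (h1 : 1 / 5 < a) (h2 : a < 2 / 5) : a ∉ α := by
  refine fun ha => (hα.clamp hP).notMem_left_gap_of_subset hP hn ?_ h1 h2 ⟨a, ha, ?_⟩
  · rintro _ ⟨x, -, rfl⟩
    exact ⟨le_max_left _ _, max_le zero_le_one (min_le_right _ _)⟩
  · simp only
    rw [min_eq_left (by linarith), max_eq_right (by linarith)]

end Costs

theorem optimal_sets_avoid_gaps_uniform (P : MeasureTheory.Measure ℝ)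
    (hP : IsCondensation P nuUnif) :
    ∀ n : ℕ, 3 ≤ n → ∀ α : Set ℝ, IsOptimalSet P n α →
      α ∩ Set.Ioo (1 / 5 : ℝ) (2 / 5) = ∅ ∧ α ∩ Set.Ioo (3 / 5 : ℝ) (4 / 5) = ∅ := by
  intro n hn α hα
  refine ⟨eq_empty_of_forall_notMem fun a ⟨ha, h1, h2⟩ => hα.notMem_left_gap hP hn h1 h2 ha,
    eq_empty_of_forall_notMem fun a ⟨ha, h1, h2⟩ => ?_⟩
  exact hα.reflect.notMem_left_gap hP.reflect hn (a := 1 - a) (by linarith) (by linarith)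
    (by simpa using ha)
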